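/- arXiv:1610.01495 — 3 statements merged into one kernel-verified Lean document; each statement's English description precedes it below -/
import Mathlib

section
/- Let λ = (λ₁, λ₂), ρ = (ρ₁, ρ₂) ∈ ℝ² with λ₂ = ρ₂, let X = [X_L X_R] be the associated 3×6 matrix, and let b = (b₁, b₂, b₃) ∈ ℝ³ with b₁ = 0. If f ∈ ℝ⁶ satisfies X f = b and f is orthogonal to the kernel of X (equivalently, f lies in the range of Xᵀ, so that f is the minimum-norm solution f = X†b), then the tangential components of f vanish: f₁ = 0 and f₄ = 0. -/
open Matrix

/-- If `λ₂ = ρ₂`, `b₁ = 0`, `X f = b`, and `f` is orthogonal to `ker X`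
(i.e. `f` is the minimum-norm solution `X†b`), then the tangential components
of `f` vanish: `f₁ = 0` and `f₄ = 0`. -/
theorem fourbar_min_norm_solution_zero_tangential
    (lam₁ lam₂ ρ₁ ρ₂ : ℝ) (h : lam₂ = ρ₂) (b : Fin 3 → ℝ) (hb : b 0 = 0)
    (f : Fin 6 → ℝ)
    (X : Matrix (Fin 3) (Fin 6) ℝ)
    (hX : X = !![(1 : ℝ), 0, 0, 1, 0, 0;
                 0, 1, 0, 0, 1, 0;
                 -lam₂, lam₁, 1, -ρ₂, ρ₁, 1])
    (hf : X.mulVec f = b)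
    (horth : ∀ k : Fin 6 → ℝ, X.mulVec k = 0 → f ⬝ᵥ k = 0) :
    f 0 = 0 ∧ f 3 = 0 := by
  subst hX h
  have hsum : f 0 + f 3 = 0 := by
    have h₀ := congrFun hf 0
    rw [hb] at h₀
    simpa [mulVec, dotProduct, Fin.sum_univ_six] using h₀
  have hdiff : f 0 - f 3 = 0 := by
    have hk := horth ![1, 0, 0, -1, 0, 0] (by
      ext i
      fin_cases i <;> simp [mulVec, dotProduct, Fin.sum_univ_six])
    simpa [dotProduct, Fin.sum_univ_six, sub_eq_add_neg] using hk
  constructor <;> linarith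
end

section
/- (Corollary: minimizing the tangential contact force is equivalent to minimizing the contact wrench norm.) Let λ = (λ₁, λ₂), ρ = (ρ₁, ρ₂) ∈ ℝ² with λ₂ = ρ₂, let X = [X_L X_R], and let b ∈ ℝ³ with b₁ = 0. Let f* ∈ ℝ⁶ be the minimum-norm solution of X f = b, i.e., the unique solution orthogonal to ker X. Then f* simultaneously minimizes the tangential force norm: for every g ∈ ℝ⁶ with X g = b one has (f*₁)² + (f*₄)² ≤ g₁² + g₄². -/
open Matrix

/-- Corollary: the minimum-norm solution `f*` of `X f = b` (with `λ₂ = ρ₂`,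
`b₁ = 0`) also minimizes the tangential force norm: for every `g` with
`X g = b`, `(f*₁)² + (f*₄)² ≤ g₁² + g₄²`. -/
theorem fourbar_min_norm_minimizes_tangential
    (lam₁ lam₂ ρ₁ ρ₂ : ℝ) (h : lam₂ = ρ₂) (b : Fin 3 → ℝ) (hb : b 0 = 0)
    (fstar : Fin 6 → ℝ)
    (X : Matrix (Fin 3) (Fin 6) ℝ)
    (hX : X = !![(1 : ℝ), 0, 0, 1, 0, 0;
                 0, 1, 0, 0, 1, 0;
                 -lam₂, lam₁, 1, -ρ₂, ρ₁, 1])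
    (hf : X.mulVec fstar = b)
    (horth : ∀ k : Fin 6 → ℝ, X.mulVec k = 0 → fstar ⬝ᵥ k = 0) :
    ∀ g : Fin 6 → ℝ, X.mulVec g = b →
      (fstar 0) ^ 2 + (fstar 3) ^ 2 ≤ (g 0) ^ 2 + (g 3) ^ 2 := by
  intro g _
  subst h hX
  have hsum : fstar 0 + fstar 3 = 0 := by
    have h0 := congrFun hf 0
    rw [hb] at h0
    simpa [Matrix.mulVec, dotProduct, Fin.sum_univ_six] using h0
  have hdiff := horth ![1, 0, 0, -1, 0, 0] (by
    ext i
    fin_cases i <;> simp [Matrix.mulVec, dotProduct, Fin.sum_univ_six])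
  simp [dotProduct, Fin.sum_univ_six] at hdiff
  have hleft : fstar 0 = 0 := by linarith
  have hright : fstar 3 = 0 := by linarith
  rw [hleft, hright]
  nlinarith [sq_nonneg (g 0), sq_nonneg (g 3)]
end

section
/- Let λ = (λ₁, λ₂), ρ = (ρ₁, ρ₂) ∈ ℝ² with λ₂ = ρ₂, let X = [X_L X_R] ∈ ℝ^{3×6}, and let N := I₆ − Xᵀ (X Xᵀ)⁻¹ X be the orthogonal projector onto the kernel of X (X Xᵀ is invertible since X has full row rank). Then the rows of N selected by the tangential components satisfy e₁ᵀ N = (1/2)(1, 0, 0, −1, 0, 0) and e₄ᵀ N = (1/2)(−1, 0, 0, 1, 0, 0). -/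
open Matrix

/-- If column `i` of `X` is the combination `c` of the rows of `X * Xᵀ`, then row `i` of the
projector onto `ker X` is the `i`-th basis vector minus the combination `c` of the rows of `X`. -/
theorem one_sub_rowSpace_projector_row {m n : Type*} [Fintype m] [DecidableEq m] [Fintype n]
    [DecidableEq n] {R : Type*} [CommRing R] (X : Matrix m n R) (hX : IsUnit (X * Xᵀ).det)
    (i : n) (c : m → R) (hc : Xᵀ i = c ᵥ* (X * Xᵀ)) :
    (1 - Xᵀ * (X * Xᵀ)⁻¹ * X : Matrix n n R) i = (1 : Matrix n n R) i - c ᵥ* X := by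
  have key : (Xᵀ * (X * Xᵀ)⁻¹ * X) i = c ᵥ* X := by
    rw [Matrix.mul_assoc, Matrix.mul_apply_eq_vecMul, hc, Matrix.vecMul_vecMul, ← Matrix.mul_assoc,
      Matrix.mul_nonsing_inv _ hX, Matrix.one_mul]
  rw [← key]
  rfl

/-- With `λ₂ = ρ₂` and `N := I₆ − Xᵀ(XXᵀ)⁻¹X` the orthogonal projector onto
`ker X`, the tangential rows of `N` are
`e₁ᵀN = (1/2)(1,0,0,−1,0,0)` and `e₄ᵀN = (1/2)(−1,0,0,1,0,0)`. -/
theorem fourbar_nullspace_projector_tangential_rows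
    (lam₁ lam₂ ρ₁ ρ₂ : ℝ) (h : lam₂ = ρ₂)
    (X : Matrix (Fin 3) (Fin 6) ℝ)
    (hX : X = !![(1 : ℝ), 0, 0, 1, 0, 0;
                 0, 1, 0, 0, 1, 0;
                 -lam₂, lam₁, 1, -ρ₂, ρ₁, 1])
    (N : Matrix (Fin 6) (Fin 6) ℝ)
    (hN : N = 1 - Xᵀ * (X * Xᵀ)⁻¹ * X) :
    (fun j => N 0 j) = ![1/2, 0, 0, -1/2, 0, 0] ∧
      (fun j => N 3 j) = ![-1/2, 0, 0, 1/2, 0, 0] := by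
  subst h hN
  have hG : X * Xᵀ = !![2, 0, -2 * lam₂; 0, 2, lam₁ + ρ₁;
      -2 * lam₂, lam₁ + ρ₁, 2 * lam₂ ^ 2 + lam₁ ^ 2 + ρ₁ ^ 2 + 2] := by
    subst hX
    ext i j
    fin_cases i <;> fin_cases j <;> simp [Matrix.mul_apply, Fin.sum_univ_succ] <;> ring
  have hdet : IsUnit (X * Xᵀ).det := by
    have hval : (X * Xᵀ).det = 2 * (lam₁ - ρ₁) ^ 2 + 8 := by
      rw [hG, Matrix.det_fin_three]
      simp
      ring
    rw [hval]
    exact (by positivity : 2 * (lam₁ - ρ₁) ^ 2 + 8 ≠ 0).isUnit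
  have hrow (i : Fin 6) (hi : Xᵀ i = ![1, 0, -lam₂]) :=
    one_sub_rowSpace_projector_row X hdet i ![1/2, 0, 0] (by
      rw [hi, hG]
      ext j
      fin_cases j <;> simp [Matrix.vecMul, dotProduct, Fin.sum_univ_succ])
  constructor
  · refine (hrow 0 (by subst hX; ext j; fin_cases j <;> rfl)).trans ?_
    subst hX
    ext j
    fin_cases j <;>
      norm_num [Matrix.vecMul, dotProduct, Fin.sum_univ_succ, Matrix.one_apply, Fin.ext_iff]
  · refine (hrow 3 (by subst hX; ext j; fin_cases j <;> rfl)).trans ?_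
    subst hX
    ext j
    fin_cases j <;>
      norm_num [Matrix.vecMul, dotProduct, Fin.sum_univ_succ, Matrix.one_apply, Fin.ext_iff]
end
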